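/- Let Q denote the Minkowski quadratic form on ℝ⁴: Q(x) = −x₀² + x₁² + x₂² + x₃². For p ∈ ℝ⁴ and α > 0 define χ_p^α(x) = (α/π)² · exp(−α‖x − p‖²), where ‖·‖ is the Euclidean norm on ℝ⁴, and set f_α = χ_p^α − χ_q^α. Let p, q ∈ ℝ⁴ with p ≠ q and Q(p − q) ≠ 0. Then ∫∫_{ℝ⁴×ℝ⁴} f_α(x) · f_α(y) · log|Q(x − y)| dx dy tends to −∞ as α → ∞; in particular this double integral is negative for all sufficiently large α. -/

import Mathlib

open Real MeasureTheory Filter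

/-- The Minkowski quadratic form on `ℝ⁴`. -/
noncomputable def minkQ (x : EuclideanSpace ℝ (Fin 4)) : ℝ :=
  -(x 0) ^ 2 + (x 1) ^ 2 + (x 2) ^ 2 + (x 3) ^ 2

/-- The normalized Gaussian of width `1/√α` centered at `p`. -/
noncomputable def gaussChi (α : ℝ) (p x : EuclideanSpace ℝ (Fin 4)) : ℝ :=
  (α / π) ^ 2 * Real.exp (-α * ‖x - p‖ ^ 2)

/-- If `c` grows at unit speed along the direction `v`, the singularity `k ∘ c` is averaged out by
translating along `v`, so it is integrable against any sufficiently regular weight. -/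
lemma lintegral_mul_comp_le_of_unit_speed {V : Type*} [AddCommGroup V] [Module ℝ V]
    [MeasurableSpace V] [MeasurableAdd₂ V] [MeasurableSMul₂ ℝ V] {μ : Measure V} [SFinite μ]
    [μ.IsAddRightInvariant] {c : V → ℝ} {v : V} {G H : V → ENNReal} {k : ℝ → ENNReal}
    (hc : Measurable c) (hH : Measurable H) (hk : Measurable k)
    (hcv : ∀ w t, c (w + t • v) = c w + t)
    (hGH : ∀ w, ∀ t ∈ Set.Icc (0 : ℝ) 1, G (w + t • v) ≤ H w) :
    ∫⁻ w, G w * k (c w) ∂μ ≤ (∫⁻ s, k s) * ∫⁻ w, H w ∂μ := by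
  have htranslate : ∀ t : ℝ, ∫⁻ w, G w * k (c w) ∂μ
      = ∫⁻ w, G (w + t • v) * k (c w + t) ∂μ := fun t => by
    rw [← lintegral_add_right_eq_self (fun w => G w * k (c w)) (t • v)]
    simp only [hcv]
  calc ∫⁻ w, G w * k (c w) ∂μ
      = ∫⁻ t in Set.Icc (0 : ℝ) 1, ∫⁻ w, G w * k (c w) ∂μ := by simp
    _ = ∫⁻ t in Set.Icc (0 : ℝ) 1, ∫⁻ w, G (w + t • v) * k (c w + t) ∂μ := by
        simp only [← htranslate]
    _ ≤ ∫⁻ t in Set.Icc (0 : ℝ) 1, ∫⁻ w, H w * k (c w + t) ∂μ := by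
        refine setLIntegral_mono' measurableSet_Icc fun t ht => lintegral_mono fun w => ?_
        gcongr
        exact hGH w t ht
    _ = ∫⁻ w, (∫⁻ t in Set.Icc (0 : ℝ) 1, H w * k (c w + t)) ∂μ := by
        refine lintegral_lintegral_swap (Measurable.aemeasurable ?_)
        fun_prop
    _ ≤ ∫⁻ w, H w * (∫⁻ s, k s) ∂μ := by
        refine lintegral_mono fun w => ?_
        rw [← lintegral_add_left_eq_self k (c w),
          ← lintegral_const_mul _ (by fun_prop)]
        exact setLIntegral_le_lintegral _ _
    _ = (∫⁻ s, k s) * ∫⁻ w, H w ∂μ := by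
        rw [lintegral_mul_const _ hH, mul_comm]

/-- The singular part of the logarithm. -/
noncomputable def logSing (s : ℝ) : ℝ :=
  Set.indicator (Set.Icc (-1) 1) (fun s => |Real.log s|) s

lemma logSing_nonneg (s : ℝ) : 0 ≤ logSing s :=
  Set.indicator_nonneg (fun _ _ => abs_nonneg _) s

lemma measurable_logSing : Measurable logSing :=
  (Real.measurable_log.norm).indicator measurableSet_Icc

lemma lintegral_logSing_lt_top : ∫⁻ s, ENNReal.ofReal (logSing s) < ⊤ := by
  have h : Integrable logSing := by
    refine IntegrableOn.integrable_indicator ?_ measurableSet_Icc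
    have := (intervalIntegral.intervalIntegrable_log' (a := -1) (b := 1)).norm
    rwa [intervalIntegrable_iff_integrableOn_Icc_of_le (by norm_num)] at this
  exact h.lintegral_lt_top

lemma abs_log_le_logSing_add_abs (s : ℝ) : |Real.log s| ≤ logSing s + |s| := by
  by_cases hs : s ∈ Set.Icc (-1 : ℝ) 1
  · rw [logSing, Set.indicator_of_mem hs]
    linarith [abs_nonneg s]
  · rw [logSing, Set.indicator_of_notMem hs, zero_add, ← Real.log_abs]
    have h1 : 1 ≤ |s| := by
      by_contra! h
      exact hs (abs_le.1 h.le)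
    rw [abs_of_nonneg (Real.log_nonneg h1)]
    linarith [Real.log_le_sub_one_of_pos (by linarith : 0 < |s|)]

local notation "E4" => EuclideanSpace ℝ (Fin 4)

/-- The squared distance from `w` to `(p, q)`. -/
noncomputable def sqDist (p q : E4) (w : E4 × E4) : ℝ := ‖w.1 - p‖ ^ 2 + ‖w.2 - q‖ ^ 2

lemma sqDist_nonneg (p q : E4) (w : E4 × E4) : 0 ≤ sqDist p q w := by
  unfold sqDist; positivity

@[fun_prop]
lemma continuous_sqDist (p q : E4) : Continuous (sqDist p q) := by
  unfold sqDist; fun_prop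

lemma exp_sqDist_eq_mul (a : ℝ) (p q : E4) (w : E4 × E4) :
    Real.exp (-a * sqDist p q w)
      = Real.exp (-a * ‖w.1 - p‖ ^ 2) * Real.exp (-a * ‖w.2 - q‖ ^ 2) := by
  rw [← Real.exp_add, sqDist, mul_add]

lemma integral_exp_sqDist {a : ℝ} (ha : 0 < a) (p q : E4) :
    ∫ w, Real.exp (-a * sqDist p q w) ∂((volume : Measure E4).prod volume) = (π / a) ^ 4 := by
  have h : ∀ p : E4, ∫ x : E4, Real.exp (-a * ‖x - p‖ ^ 2) = (π / a) ^ 2 := fun p => by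
    rw [integral_sub_right_eq_self (fun x : E4 => Real.exp (-a * ‖x‖ ^ 2)) p,
      GaussianFourier.integral_rexp_neg_mul_sq_norm ha]
    norm_num
  simp only [exp_sqDist_eq_mul]
  rw [integral_prod_mul (fun x : E4 => Real.exp (-a * ‖x - p‖ ^ 2))
    (fun y : E4 => Real.exp (-a * ‖y - q‖ ^ 2)), h, h]
  ring

lemma integrable_exp_sqDist {a : ℝ} (ha : 0 < a) (p q : E4) :
    Integrable (fun w => Real.exp (-a * sqDist p q w)) ((volume : Measure E4).prod volume) := by
  refine Integrable.of_integral_ne_zero ?_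
  rw [integral_exp_sqDist ha]
  positivity

lemma mul_exp_le {a : ℝ} (ha : 0 < a) (s : ℝ) :
    s * Real.exp (-a * s) ≤ 2 / a * Real.exp (-(a / 2) * s) := by
  have h1 : s ≤ 2 / a * Real.exp (a / 2 * s) := by
    have := Real.add_one_le_exp (a / 2 * s)
    rw [div_mul_eq_mul_div, le_div_iff₀ ha]
    linarith
  calc s * Real.exp (-a * s)
      ≤ 2 / a * Real.exp (a / 2 * s) * Real.exp (-a * s) := by gcongr
    _ = 2 / a * Real.exp (-(a / 2) * s) := by
        rw [mul_assoc, ← Real.exp_add]; ring_nf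

lemma integrable_sqDist_mul_exp {a : ℝ} (ha : 0 < a) (p q : E4) :
    Integrable (fun w => sqDist p q w * Real.exp (-a * sqDist p q w))
      ((volume : Measure E4).prod volume) := by
  refine Integrable.mono' ((integrable_exp_sqDist (half_pos ha) p q).const_mul (2 / a))
    (Continuous.aestronglyMeasurable (by fun_prop)) (ae_of_all _ fun w => ?_)
  rw [Real.norm_of_nonneg (mul_nonneg (sqDist_nonneg p q w) (Real.exp_nonneg _))]
  exact mul_exp_le ha _

lemma half_sqDist_le_sqDist_add {v : E4} (hv : ‖v‖ = 1) {t : ℝ} (ht : t ∈ Set.Icc (0 : ℝ) 1)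
    (p q : E4) (w : E4 × E4) :
    sqDist p q w / 2 - 1 ≤ sqDist p q (w + t • (v, 0)) := by
  have h : ‖w.1 - p‖ ≤ ‖w.1 + t • v - p‖ + 1 := by
    calc ‖w.1 - p‖ = ‖(w.1 + t • v - p) - t • v‖ := by congr 1; abel
      _ ≤ ‖w.1 + t • v - p‖ + ‖t • v‖ := norm_sub_le _ _
      _ ≤ ‖w.1 + t • v - p‖ + 1 := by
        rw [norm_smul, hv, mul_one, Real.norm_of_nonneg ht.1]
        linarith [ht.2]
  simp only [sqDist, Prod.fst_add, Prod.snd_add, Prod.smul_mk, smul_zero, add_zero]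
  nlinarith [sq_nonneg (‖w.1 + t • v - p‖ - 1), norm_nonneg (w.1 - p), sq_nonneg ‖w.2 - q‖]

lemma lintegral_exp_sqDist_mul_comp_le {a : ℝ} (ha : 0 < a) (p q : E4) {v : E4} (hv : ‖v‖ = 1)
    {c : E4 × E4 → ℝ} (hc : Measurable c) (hcv : ∀ w t, c (w + t • (v, 0)) = c w + t)
    {k : ℝ → ENNReal} (hk : Measurable k) :
    ∫⁻ w, ENNReal.ofReal (Real.exp (-a * sqDist p q w)) * k (c w)
        ∂((volume : Measure E4).prod volume)
      ≤ (∫⁻ s, k s) * ∫⁻ w, ENNReal.ofReal (Real.exp a * Real.exp (-(a / 2) * sqDist p q w))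
        ∂((volume : Measure E4).prod volume) := by
  refine lintegral_mul_comp_le_of_unit_speed hc
    (Continuous.measurable (by fun_prop)).ennreal_ofReal hk hcv ?_
  intro w t ht
  refine ENNReal.ofReal_le_ofReal ?_
  rw [← Real.exp_add, Real.exp_le_exp]
  nlinarith [half_sqDist_le_sqDist_add hv ht p q w]

lemma integrable_exp_sqDist_mul_logSing {a : ℝ} (ha : 0 < a) (p q : E4) {v : E4} (hv : ‖v‖ = 1)
    {c : E4 × E4 → ℝ} (hc : Measurable c) (hcv : ∀ w t, c (w + t • (v, 0)) = c w + t) :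
    Integrable (fun w => Real.exp (-a * sqDist p q w) * logSing (c w))
      ((volume : Measure E4).prod volume) := by
  refine ⟨((Continuous.measurable (by fun_prop)).mul
    (measurable_logSing.comp hc)).aestronglyMeasurable, ?_⟩
  rw [hasFiniteIntegral_iff_ofReal
    (ae_of_all _ fun w => mul_nonneg (Real.exp_nonneg _) (logSing_nonneg _))]
  simp only [ENNReal.ofReal_mul (Real.exp_nonneg _)]
  refine (lintegral_exp_sqDist_mul_comp_le ha p q hv hc hcv
    measurable_logSing.ennreal_ofReal).trans_lt (ENNReal.mul_lt_top lintegral_logSing_lt_top ?_)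
  exact ((integrable_exp_sqDist (half_pos ha) p q).const_mul (Real.exp a)).lintegral_lt_top

lemma ae_ne_zero_of_unit_speed {v : E4} (hv : ‖v‖ = 1)
    {c : E4 × E4 → ℝ} (hc : Measurable c) (hcv : ∀ w t, c (w + t • (v, 0)) = c w + t) :
    ∀ᵐ w ∂((volume : Measure E4).prod volume), c w ≠ 0 := by
  have hk : Measurable (Set.indicator {(0 : ℝ)} (fun _ => (1 : ENNReal))) :=
    measurable_const.indicator (measurableSet_singleton 0)
  have h := lintegral_exp_sqDist_mul_comp_le one_pos 0 0 hv hc hcv hk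
  rw [lintegral_indicator (measurableSet_singleton 0)] at h
  simp only [lintegral_const, Measure.restrict_apply_univ, Real.volume_singleton, mul_zero,
    zero_mul, nonpos_iff_eq_zero] at h
  have hmeas : Measurable fun w => ENNReal.ofReal (Real.exp (-1 * sqDist 0 0 w)) *
      Set.indicator {(0 : ℝ)} (fun _ => (1 : ENNReal)) (c w) :=
    (Continuous.measurable (by fun_prop)).ennreal_ofReal.mul (hk.comp hc)
  rw [lintegral_eq_zero_iff hmeas] at h
  filter_upwards [h] with w hw h0
  simp only [h0, Pi.zero_apply, Set.mem_singleton_iff, Set.indicator_of_mem, mul_one,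
    ENNReal.ofReal_eq_zero] at hw
  exact hw.not_gt (Real.exp_pos _)

/-- The Euclidean norm of the spatial part of a vector. -/
noncomputable def spatialNorm (z : E4) : ℝ := √((z 1) ^ 2 + (z 2) ^ 2 + (z 3) ^ 2)

lemma minkQ_eq_neg_mul (z : E4) :
    minkQ z = -((z 0 - spatialNorm z) * (z 0 + spatialNorm z)) := by
  have h : spatialNorm z ^ 2 = (z 1) ^ 2 + (z 2) ^ 2 + (z 3) ^ 2 := Real.sq_sqrt (by positivity)
  rw [minkQ]
  linarith

lemma norm_sq_eq_sum_four (z : E4) : ‖z‖ ^ 2 = (z 0) ^ 2 + (z 1) ^ 2 + (z 2) ^ 2 + (z 3) ^ 2 := by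
  simp [EuclideanSpace.norm_sq_eq, Fin.sum_univ_four]

lemma spatialNorm_le (z : E4) : spatialNorm z ≤ ‖z‖ :=
  Real.sqrt_le_iff.2 ⟨norm_nonneg z, by rw [norm_sq_eq_sum_four]; nlinarith [sq_nonneg (z 0)]⟩

lemma abs_zero_coord_le (z : E4) : |z 0| ≤ ‖z‖ := PiLp.norm_apply_le z 0

lemma abs_minkQ_le (z : E4) : |minkQ z| ≤ ‖z‖ ^ 2 := by
  rw [norm_sq_eq_sum_four, minkQ, abs_le]
  constructor <;>
    nlinarith [sq_nonneg (z 0), sq_nonneg (z 1), sq_nonneg (z 2), sq_nonneg (z 3)]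

@[fun_prop]
lemma continuous_minkQ : Continuous minkQ := by
  unfold minkQ; fun_prop

@[fun_prop]
lemma continuous_spatialNorm : Continuous spatialNorm := by
  unfold spatialNorm; fun_prop

lemma norm_sub_sq_le (p : E4) (w : E4 × E4) : ‖w.1 - w.2‖ ^ 2 ≤ 2 * sqDist p p w := by
  have h : ‖w.1 - w.2‖ ≤ ‖w.1 - p‖ + ‖w.2 - p‖ := by
    simpa using norm_sub_le (w.1 - p) (w.2 - p)
  rw [sqDist]
  nlinarith [norm_nonneg (w.1 - w.2), sq_nonneg (‖w.1 - p‖ - ‖w.2 - p‖)]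

lemma norm_sub_le_sqDist (p q : E4) (w : E4 × E4) :
    ‖w.1 - w.2‖ ≤ ‖p - q‖ + 2 + sqDist p q w := by
  have h : ‖w.1 - w.2‖ ≤ ‖w.1 - p‖ + ‖w.2 - q‖ + ‖p - q‖ := by
    calc ‖w.1 - w.2‖ = ‖(w.1 - p) - (w.2 - q) + (p - q)‖ := by congr 1; abel
      _ ≤ _ := (norm_add_le _ _).trans (by gcongr; exact norm_sub_le _ _)
  rw [sqDist]
  nlinarith [sq_nonneg (‖w.1 - p‖ - 1), sq_nonneg (‖w.2 - q‖ - 1), sq_nonneg ‖w.1 - p‖,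
    sq_nonneg ‖w.2 - q‖]

/-- A function cutting out one half of the light cone of `w.1 - w.2`. -/
noncomputable def lightConeSub (w : E4 × E4) : ℝ := (w.1 - w.2) 0 - spatialNorm (w.1 - w.2)

/-- A function cutting out the other half of the light cone of `w.1 - w.2`. -/
noncomputable def lightConeAdd (w : E4 × E4) : ℝ := (w.1 - w.2) 0 + spatialNorm (w.1 - w.2)

lemma measurable_lightConeSub : Measurable lightConeSub := by
  refine Continuous.measurable ?_
  unfold lightConeSub
  fun_prop

lemma measurable_lightConeAdd : Measurable lightConeAdd := by
  refine Continuous.measurable ?_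
  unfold lightConeAdd
  fun_prop

lemma lightConeSub_add_smul (w : E4 × E4) (t : ℝ) :
    lightConeSub (w + t • (EuclideanSpace.single 0 1, 0)) = lightConeSub w + t := by
  simp [lightConeSub, spatialNorm]
  ring

lemma lightConeAdd_add_smul (w : E4 × E4) (t : ℝ) :
    lightConeAdd (w + t • (EuclideanSpace.single 0 1, 0)) = lightConeAdd w + t := by
  simp [lightConeAdd, spatialNorm]
  ring

lemma norm_timeDirection : ‖(EuclideanSpace.single 0 1 : E4)‖ = 1 := by simp

lemma ae_minkQ_sub_ne_zero :
    ∀ᵐ w ∂((volume : Measure E4).prod volume), minkQ (w.1 - w.2) ≠ 0 := by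
  filter_upwards [ae_ne_zero_of_unit_speed norm_timeDirection
      measurable_lightConeSub lightConeSub_add_smul,
    ae_ne_zero_of_unit_speed norm_timeDirection
      measurable_lightConeAdd lightConeAdd_add_smul] with w h1 h2
  rw [minkQ_eq_neg_mul]
  exact neg_ne_zero.2 (mul_ne_zero h1 h2)

lemma abs_log_abs_minkQ_le (z : E4) :
    |(Real.log |minkQ z|)| ≤ logSing (z 0 - spatialNorm z) + logSing (z 0 + spatialNorm z)
      + 4 * ‖z‖ := by
  have hn : 0 ≤ spatialNorm z := Real.sqrt_nonneg _
  have hz := abs_zero_coord_le z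
  have hs := spatialNorm_le z
  have h1 : |z 0 - spatialNorm z| ≤ 2 * ‖z‖ := by
    rw [abs_le] at hz ⊢; constructor <;> linarith [hz.1, hz.2]
  have h2 : |z 0 + spatialNorm z| ≤ 2 * ‖z‖ := by
    rw [abs_le] at hz ⊢; constructor <;> linarith [hz.1, hz.2]
  rw [Real.log_abs, minkQ_eq_neg_mul, Real.log_neg_eq_log]
  by_cases ha : z 0 - spatialNorm z = 0
  · rw [ha]
    simp only [zero_mul, Real.log_zero, abs_zero]
    have := logSing_nonneg 0
    have := logSing_nonneg (z 0 + spatialNorm z)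
    positivity
  by_cases hb : z 0 + spatialNorm z = 0
  · rw [hb]
    simp only [mul_zero, Real.log_zero, abs_zero]
    have := logSing_nonneg 0
    have := logSing_nonneg (z 0 - spatialNorm z)
    positivity
  rw [Real.log_mul ha hb]
  linarith [abs_add_le (Real.log (z 0 - spatialNorm z)) (Real.log (z 0 + spatialNorm z)),
    abs_log_le_logSing_add_abs (z 0 - spatialNorm z),
    abs_log_le_logSing_add_abs (z 0 + spatialNorm z)]

lemma integrable_exp_sqDist_mul_log {a : ℝ} (ha : 0 < a) (p q : E4) :
    Integrable (fun w => Real.exp (-a * sqDist p q w) * Real.log |minkQ (w.1 - w.2)|)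
      ((volume : Measure E4).prod volume) := by
  have h1 := integrable_exp_sqDist_mul_logSing ha p q norm_timeDirection
    measurable_lightConeSub lightConeSub_add_smul
  have h2 := integrable_exp_sqDist_mul_logSing ha p q norm_timeDirection
    measurable_lightConeAdd lightConeAdd_add_smul
  have h3 := (integrable_exp_sqDist ha p q).const_mul (4 * (‖p - q‖ + 2))
  have h4 := (integrable_sqDist_mul_exp ha p q).const_mul 4
  refine Integrable.mono' (((h1.add h2).add h3).add h4) ?_ (ae_of_all _ fun w => ?_)
  · refine Measurable.aestronglyMeasurable (Measurable.mul (Continuous.measurable (by fun_prop)) ?_)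
    exact Real.measurable_log.comp (Continuous.measurable (by fun_prop))
  · rw [norm_mul, Real.norm_of_nonneg (Real.exp_nonneg _), Real.norm_eq_abs]
    have h : |(Real.log |minkQ (w.1 - w.2)|)| ≤
        logSing ((w.1 - w.2) 0 - spatialNorm (w.1 - w.2))
        + logSing ((w.1 - w.2) 0 + spatialNorm (w.1 - w.2))
        + 4 * (‖p - q‖ + 2) + 4 * sqDist p q w := by
      linarith [abs_log_abs_minkQ_le (w.1 - w.2), norm_sub_le_sqDist p q w]
    refine (mul_le_mul_of_nonneg_left h (Real.exp_nonneg _)).trans_eq ?_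
    simp only [Pi.add_apply, lightConeSub, lightConeAdd]
    ring

/-- The energy of a pair of Gaussians centered at `p` and `q`. -/
noncomputable def gaussEnergy (α : ℝ) (p q : E4) : ℝ :=
  ∫ w, (α / π) ^ 4 * (Real.exp (-α * sqDist p q w) * Real.log |minkQ (w.1 - w.2)|)
    ∂((volume : Measure E4).prod volume)

lemma gaussChi_mul_gaussChi (α : ℝ) (p q x y : E4) :
    gaussChi α p x * gaussChi α q y = (α / π) ^ 4 * Real.exp (-α * sqDist p q (x, y)) := by
  rw [exp_sqDist_eq_mul, gaussChi, gaussChi]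
  ring

lemma integral_integral_eq_gaussEnergy {α : ℝ} (hα : 0 < α) (p q : E4) :
    ∫ x : E4, ∫ y : E4,
        (gaussChi α p x - gaussChi α q x) * (gaussChi α p y - gaussChi α q y) *
          Real.log |minkQ (x - y)|
      = gaussEnergy α p p - gaussEnergy α p q - gaussEnergy α q p + gaussEnergy α q q := by
  have hi : ∀ p q : E4, Integrable (fun w => (α / π) ^ 4 *
      (Real.exp (-α * sqDist p q w) * Real.log |minkQ (w.1 - w.2)|))
      ((volume : Measure E4).prod volume) :=
    fun p q => (integrable_exp_sqDist_mul_log hα p q).const_mul _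
  have hpt : ∀ w : E4 × E4,
      (gaussChi α p w.1 - gaussChi α q w.1) * (gaussChi α p w.2 - gaussChi α q w.2) *
          Real.log |minkQ (w.1 - w.2)|
        = (α / π) ^ 4 * (Real.exp (-α * sqDist p p w) * Real.log |minkQ (w.1 - w.2)|)
        - (α / π) ^ 4 * (Real.exp (-α * sqDist p q w) * Real.log |minkQ (w.1 - w.2)|)
        - (α / π) ^ 4 * (Real.exp (-α * sqDist q p w) * Real.log |minkQ (w.1 - w.2)|)
        + (α / π) ^ 4 * (Real.exp (-α * sqDist q q w) * Real.log |minkQ (w.1 - w.2)|) := by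
    intro w
    have h := fun p q => gaussChi_mul_gaussChi α p q w.1 w.2
    simp only [← mul_assoc, Prod.mk.eta] at h ⊢
    simp only [← h]
    ring
  have hint := (((hi p p).sub (hi p q)).sub (hi q p)).add (hi q q)
  unfold gaussEnergy
  rw [← integral_sub' (hi p p) (hi p q), ← integral_sub' ((hi p p).sub (hi p q)) (hi q p),
    ← integral_add' (((hi p p).sub (hi p q)).sub (hi q p)) (hi q q)]
  rw [integral_prod _ hint]
  refine integral_congr_ae (ae_of_all _ fun x => integral_congr_ae (ae_of_all _ fun y => ?_))
  exact hpt (x, y)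

lemma integral_gaussWeight {α : ℝ} (hα : 0 < α) (p q : E4) :
    ∫ w, (α / π) ^ 4 * Real.exp (-α * sqDist p q w) ∂((volume : Measure E4).prod volume) = 1 := by
  rw [integral_const_mul, integral_exp_sqDist hα, ← mul_pow]
  field_simp

lemma gaussEnergy_self_le {α : ℝ} (hα : 0 < α) (p : E4) :
    gaussEnergy α p p ≤ 64 - Real.log α := by
  have hE := (integrable_exp_sqDist hα p p).const_mul ((α / π) ^ 4)
  have hE2 := (integrable_exp_sqDist (half_pos hα) p p).const_mul (4 * (α / π) ^ 4)
  have hle : gaussEnergy α p p ≤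
      ∫ w, (4 * (α / π) ^ 4 * Real.exp (-(α / 2) * sqDist p p w)
        - Real.log α * ((α / π) ^ 4 * Real.exp (-α * sqDist p p w)))
        ∂((volume : Measure E4).prod volume) := by
    refine integral_mono_ae ((integrable_exp_sqDist_mul_log hα p p).const_mul _)
      (hE2.sub (hE.const_mul _)) ?_
    filter_upwards [ae_minkQ_sub_ne_zero] with w hw
    have hQ : 0 < |minkQ (w.1 - w.2)| := abs_pos.2 hw
    have hlog : Real.log |minkQ (w.1 - w.2)| ≤ 2 * α * sqDist p p w - Real.log α := by
      have h1 := Real.log_le_sub_one_of_pos (mul_pos hα hQ)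
      rw [Real.log_mul hα.ne' hQ.ne'] at h1
      have h2 := mul_le_mul_of_nonneg_left
        ((abs_minkQ_le (w.1 - w.2)).trans (norm_sub_sq_le p w)) hα.le
      linarith
    have hS : 2 * α * (sqDist p p w * Real.exp (-α * sqDist p p w))
        ≤ 4 * Real.exp (-(α / 2) * sqDist p p w) := by
      refine (mul_le_mul_of_nonneg_left (mul_exp_le hα _) (by positivity)).trans_eq ?_
      field_simp
      norm_num
    have h3 := mul_le_mul_of_nonneg_left hlog (Real.exp_nonneg (-α * sqDist p p w))
    have h4 : Real.exp (-α * sqDist p p w) * Real.log |minkQ (w.1 - w.2)|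
        ≤ 4 * Real.exp (-(α / 2) * sqDist p p w)
          - Real.log α * Real.exp (-α * sqDist p p w) := by linarith
    refine (mul_le_mul_of_nonneg_left h4 (by positivity : 0 ≤ (α / π) ^ 4)).trans_eq ?_
    ring
  refine hle.trans_eq ?_
  rw [integral_sub hE2 (hE.const_mul _), integral_const_mul (Real.log α),
    integral_gaussWeight hα, integral_const_mul, integral_exp_sqDist (half_pos hα)]
  field_simp
  norm_num

lemma eventually_gaussWeight_le {δ : ℝ} (hδ : 0 < δ) :
    ∀ᶠ α : ℝ in atTop, (α / π) ^ 4 * Real.exp (-((α - 1) * δ)) ≤ 1 := by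
  have h := ((Real.tendsto_pow_mul_exp_neg_atTop_nhds_zero 4).comp
    (tendsto_id.const_mul_atTop hδ)).const_mul (Real.exp δ / (δ * π) ^ 4)
  rw [mul_zero] at h
  filter_upwards [h.eventually_le_const one_pos] with α hα
  refine le_trans (le_of_eq ?_) hα
  simp only [Function.comp_apply, id]
  rw [show -((α - 1) * δ) = δ + -(δ * α) by ring, Real.exp_add]
  field_simp

lemma eventually_le_gaussEnergy {p q : E4} (hpq : minkQ (p - q) ≠ 0) :
    ∃ C : ℝ, ∀ᶠ α : ℝ in atTop, -C ≤ gaussEnergy α p q := by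
  obtain ⟨δ, hδ, hnear⟩ : ∃ δ > 0, ∀ w : E4 × E4, sqDist p q w < δ →
      |minkQ (p - q)| / 2 ≤ |minkQ (w.1 - w.2)| := by
    have hcont : Continuous fun w : E4 × E4 => |minkQ (w.1 - w.2)| := by fun_prop
    have hev : ∀ᶠ w in nhds (p, q), |minkQ (p - q)| / 2 < |minkQ (w.1 - w.2)| :=
      hcont.continuousAt.eventually_const_lt (half_lt_self (abs_pos.2 hpq))
    obtain ⟨ε, hε, h⟩ := Metric.eventually_nhds_iff.1 hev
    refine ⟨ε ^ 2, by positivity, fun w hw => (h ?_).le⟩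
    rw [sqDist] at hw
    rw [Prod.dist_eq, max_lt_iff, dist_eq_norm, dist_eq_norm]
    exact ⟨lt_of_pow_lt_pow_left₀ 2 hε.le (by nlinarith [sq_nonneg ‖w.2 - q‖]),
      lt_of_pow_lt_pow_left₀ 2 hε.le (by nlinarith [sq_nonneg ‖w.1 - p‖])⟩
  set m := |minkQ (p - q)| / 2
  have hm : 0 < m := half_pos (abs_pos.2 hpq)
  have hL := (integrable_exp_sqDist_mul_log one_pos p q).norm
  refine ⟨|Real.log m| + ∫ w, ‖Real.exp (-1 * sqDist p q w) * Real.log |minkQ (w.1 - w.2)|‖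
    ∂((volume : Measure E4).prod volume), ?_⟩
  filter_upwards [eventually_gaussWeight_le hδ, eventually_ge_atTop 1] with α hα hα1
  have hα0 : 0 < α := by linarith
  have hE := ((integrable_exp_sqDist hα0 p q).const_mul ((α / π) ^ 4)).const_mul |Real.log m|
  have hcalc := integral_mono (hE.add hL).neg
    ((integrable_exp_sqDist_mul_log hα0 p q).const_mul ((α / π) ^ 4)) (fun w => ?_)
  · simp only [Pi.neg_apply, Pi.add_apply] at hcalc
    rw [integral_neg, integral_add hE hL, integral_const_mul, integral_gaussWeight hα0,
      mul_one] at hcalc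
    exact hcalc
  · simp only [Pi.neg_apply, Pi.add_apply]
    rw [norm_mul, Real.norm_of_nonneg (Real.exp_nonneg _), Real.norm_eq_abs, ← mul_assoc]
    have hK : 0 ≤ (α / π) ^ 4 * Real.exp (-α * sqDist p q w) := by positivity
    have hE1 : 0 ≤ Real.exp (-1 * sqDist p q w) := Real.exp_nonneg _
    have hl := neg_abs_le (Real.log |minkQ (w.1 - w.2)|)
    rcases lt_or_ge (sqDist p q w) δ with hw | hw
    · have h1 := Real.log_le_log hm (hnear w hw)
      have h2 := neg_abs_le (Real.log m)
      nlinarith [mul_nonneg hE1 (abs_nonneg (Real.log |minkQ (w.1 - w.2)|)),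
        mul_le_mul_of_nonneg_left (h2.trans h1) hK]
    · have hKle : (α / π) ^ 4 * Real.exp (-α * sqDist p q w)
          ≤ Real.exp (-1 * sqDist p q w) := by
        have hexp : Real.exp (-α * sqDist p q w)
            ≤ Real.exp (-((α - 1) * δ)) * Real.exp (-1 * sqDist p q w) := by
          rw [← Real.exp_add, Real.exp_le_exp]
          nlinarith
        calc (α / π) ^ 4 * Real.exp (-α * sqDist p q w)
            ≤ (α / π) ^ 4 * (Real.exp (-((α - 1) * δ)) * Real.exp (-1 * sqDist p q w)) := by
              gcongr
          _ = (α / π) ^ 4 * Real.exp (-((α - 1) * δ)) * Real.exp (-1 * sqDist p q w) := by ring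
          _ ≤ 1 * Real.exp (-1 * sqDist p q w) := by gcongr
          _ = _ := one_mul _
      have h1 := mul_le_mul_of_nonneg_left hl hK
      have h2 := mul_le_mul_of_nonneg_right hKle (abs_nonneg (Real.log |minkQ (w.1 - w.2)|))
      have h3 := mul_nonneg (abs_nonneg (Real.log m)) hK
      linarith

lemma minkQ_sub_comm (p q : E4) : minkQ (p - q) = minkQ (q - p) := by
  simp only [minkQ, PiLp.sub_apply]
  ring

/-- With `f_α = χ_p^α − χ_q^α`, the quadratic form of the logarithmic kernel tends to
`−∞` as `α → ∞`; in particular, it is negative for all sufficiently large `α`. -/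
theorem gaussian_log_kernel_tendsto_atBot
    (p q : EuclideanSpace ℝ (Fin 4)) (hne : p ≠ q) (hpq : minkQ (p - q) ≠ 0) :
    Tendsto (fun α : ℝ =>
        ∫ x : EuclideanSpace ℝ (Fin 4), ∫ y : EuclideanSpace ℝ (Fin 4),
          (gaussChi α p x - gaussChi α q x) * (gaussChi α p y - gaussChi α q y) *
            Real.log |minkQ (x - y)|)
      atTop atBot ∧
    ∀ᶠ α : ℝ in atTop,
      (∫ x : EuclideanSpace ℝ (Fin 4), ∫ y : EuclideanSpace ℝ (Fin 4),
          (gaussChi α p x - gaussChi α q x) * (gaussChi α p y - gaussChi α q y) *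
            Real.log |minkQ (x - y)|) < 0 := by
  have hlim : Tendsto (fun α : ℝ =>
        ∫ x : EuclideanSpace ℝ (Fin 4), ∫ y : EuclideanSpace ℝ (Fin 4),
          (gaussChi α p x - gaussChi α q x) * (gaussChi α p y - gaussChi α q y) *
            Real.log |minkQ (x - y)|)
      atTop atBot := by
    obtain ⟨C, hC⟩ := eventually_le_gaussEnergy hpq
    obtain ⟨D, hD⟩ := eventually_le_gaussEnergy (minkQ_sub_comm p q ▸ hpq)
    have hbound : Tendsto (fun α : ℝ => (128 + C + D) + -(2 * Real.log α)) atTop atBot :=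
      tendsto_atBot_add_const_left _ _
        (tendsto_neg_atTop_atBot.comp (Real.tendsto_log_atTop.const_mul_atTop two_pos))
    refine Filter.tendsto_atBot_mono' _ ?_ hbound
    filter_upwards [hC, hD, eventually_gt_atTop 0] with α h1 h2 hα
    rw [integral_integral_eq_gaussEnergy hα]
    linarith [gaussEnergy_self_le hα p, gaussEnergy_self_le hα q]
  exact ⟨hlim, hlim.eventually_lt_atBot 0⟩
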